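/- Let q be a power of an odd prime with q ≡ 3 (mod 4), let E := {(x_1,x_2) ∈ F_q² : x_1² + x_2² = 1} be the unit circle in F_q², and let r ∈ F_q be a nonzero square with r ≠ 1. Then there do NOT exist (x_1,x_2,x_3) ∈ E³ and (y_1,y_2,y_3) ∈ E³ with x_i ≠ x_j and y_i ≠ y_j for all 1 ≤ i < j ≤ 3 such that ‖y_i − y_j‖ = r·‖x_i − x_j‖ for all 1 ≤ i < j ≤ 3. -/

import Mathlib

open Finset

/-- The squared side lengths of a triangle inscribed in the unit circle satisfy the
circumradius relation. -/
theorem prod_sq_sides_of_unit_circle {R : Type*} [CommRing R] {a b c d e f : R}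
    (h₁ : a ^ 2 + b ^ 2 = 1) (h₂ : c ^ 2 + d ^ 2 = 1) (h₃ : e ^ 2 + f ^ 2 = 1) {A B C : R}
    (hA : (a - c) ^ 2 + (b - d) ^ 2 = A) (hB : (a - e) ^ 2 + (b - f) ^ 2 = B)
    (hC : (c - e) ^ 2 + (d - f) ^ 2 = C) :
    A * B * C = 2 * (A * B + B * C + C * A) - A ^ 2 - B ^ 2 - C ^ 2 := by
  have gram : (a ^ 2 + b ^ 2) * (c ^ 2 + d ^ 2) * (e ^ 2 + f ^ 2)
      + 2 * (a * c + b * d) * (a * e + b * f) * (c * e + d * f)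
      - (a ^ 2 + b ^ 2) * (c * e + d * f) ^ 2 - (c ^ 2 + d ^ 2) * (a * e + b * f) ^ 2
      - (e ^ 2 + f ^ 2) * (a * c + b * d) ^ 2 = 0 := by ring
  rw [h₁, h₂, h₃] at gram
  have hA' : A = 2 - 2 * (a * c + b * d) := by linear_combination h₁ + h₂ - hA
  have hB' : B = 2 - 2 * (a * e + b * f) := by linear_combination h₁ + h₃ - hB
  have hC' : C = 2 - 2 * (c * e + d * f) := by linear_combination h₂ + h₃ - hC
  rw [hA', hB', hC']
  linear_combination -4 * gram

/-- If `-1` is not a square, then a sum of two squares vanishes only trivially. -/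
theorem eq_zero_of_sq_add_sq_eq_zero {F : Type*} [Field F] (h : ¬ IsSquare (-1 : F)) {a b : F}
    (hab : a ^ 2 + b ^ 2 = 0) : a = 0 ∧ b = 0 := by
  have hb : b = 0 := by
    by_contra hb
    refine h ⟨a / b, ?_⟩
    field_simp
    linear_combination -hab
  subst hb
  exact ⟨by simpa using hab, rfl⟩

/-- Let `q ≡ 3 (mod 4)` be a power of an odd prime, `E` the unit circle in
`F_q²`, and `r ≠ 1` a nonzero square. Then there are no triples `x, y` of pairwise distinct
points of `E` with `‖y_i − y_j‖ = r·‖x_i − x_j‖` for all `i < j`. -/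
theorem stmt_17 (p n : ℕ) (hp : p.Prime) (hp2 : p ≠ 2) (hn : 0 < n)
    (F : Type) [Field F] [Fintype F] (hq : Fintype.card F = p ^ n)
    (h4 : Fintype.card F % 4 = 3)
    (r : F) (hr : ∃ s : F, s ≠ 0 ∧ r = s ^ 2) (hr1 : r ≠ 1) :
    ¬ ∃ x y : Fin 3 → Fin 2 → F,
        (∀ i, (x i 0) ^ 2 + (x i 1) ^ 2 = 1) ∧
        (∀ i, (y i 0) ^ 2 + (y i 1) ^ 2 = 1) ∧
        (∀ i j : Fin 3, i < j → x i ≠ x j ∧ y i ≠ y j) ∧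
        (∀ i j : Fin 3, i < j →
          ∑ m, (y i m - y j m) ^ 2 = r * ∑ m, (x i m - x j m) ^ 2) := by
  rintro ⟨x, y, hx, hy, hne, hxy⟩
  have hsq : ¬ IsSquare (-1 : F) := fun h => FiniteField.isSquare_neg_one_iff.mp h h4
  have hpos : ∀ i j : Fin 3, i < j → (x i 0 - x j 0) ^ 2 + (x i 1 - x j 1) ^ 2 ≠ 0 := by
    intro i j hij h
    obtain ⟨h0, h1⟩ := eq_zero_of_sq_add_sq_eq_zero hsq h
    refine (hne i j hij).1 (funext fun m => ?_)
    fin_cases m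
    · exact sub_eq_zero.mp h0
    · exact sub_eq_zero.mp h1
  simp only [Fin.sum_univ_two] at hxy
  have h01 : (0 : Fin 3) < 1 := by decide
  have h02 : (0 : Fin 3) < 2 := by decide
  have h12 : (1 : Fin 3) < 2 := by decide
  have hX := prod_sq_sides_of_unit_circle (hx 0) (hx 1) (hx 2) rfl rfl rfl
  have hY := prod_sq_sides_of_unit_circle (hy 0) (hy 1) (hy 2)
    (hxy 0 1 h01) (hxy 0 2 h02) (hxy 1 2 h12)
  have hA := hpos 0 1 h01
  have hB := hpos 0 2 h02
  have hC := hpos 1 2 h12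
  generalize (x 0 0 - x 1 0) ^ 2 + (x 0 1 - x 1 1) ^ 2 = A at *
  generalize (x 0 0 - x 2 0) ^ 2 + (x 0 1 - x 2 1) ^ 2 = B at *
  generalize (x 1 0 - x 2 0) ^ 2 + (x 1 1 - x 2 1) ^ 2 = C at *
  obtain ⟨s, hs, rfl⟩ := hr
  have key : (s ^ 2) ^ 2 * (A * B * C) * (s ^ 2 - 1) = 0 := by
    linear_combination hY - (s ^ 2) ^ 2 * hX
  have hs1 : s ^ 2 - 1 ≠ 0 := sub_ne_zero.mpr hr1
  exact mul_ne_zero (mul_ne_zero (pow_ne_zero 2 (pow_ne_zero 2 hs))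
    (mul_ne_zero (mul_ne_zero hA hB) hC)) hs1 key
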